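/- Let T be a blocktree finset and b ∈ T. Let N be a natural number and for each slot s ∈ {0, …, N} let H_s and A_s be finite sets of votes such that no validator has a vote in both H_s and A_s, and the number of distinct validators with a vote in H_s is strictly greater than the number of distinct validators with a vote in A_s. Assume: (i) every vote in H_0 is for a descendant of b; and (ii) for every s with 1 ≤ s ≤ N and every vote (v, c) ∈ H_s, there exists a finite set of votes W with H_{s−1} ⊆ W ⊆ H_{s−1} ∪ A_{s−1} and a greedy heaviest chain of (T, W) ending at c. Then for every s ∈ {0, …, N}, every vote in H_s is for a descendant of b, and for every finite set of votes W with H_s ⊆ W ⊆ H_s ∪ A_s, every greedy heaviest chain of (T, W) contains b. -/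

import Mathlib

/-- `a` is an ancestor of `b` (equivalently, `b` is a descendant of `a`):
`a = parent^[k] b` for some `k ≥ 0`. -/
def Ancestor {B : Type*} (parent : B → B) (a b : B) : Prop :=
  ∃ k : ℕ, a = parent^[k] b

/-- Blocks `a` and `b` conflict if neither is an ancestor of the other. -/
def Conflicting {B : Type*} (parent : B → B) (a b : B) : Prop :=
  ¬ Ancestor parent a b ∧ ¬ Ancestor parent b a

/-- A finset `T` of blocks is a blocktree finset if it contains the genesis `g`
and is closed under `parent`. -/
def IsBlocktree {B : Type*} (g : B) (parent : B → B) (T : Finset B) : Prop :=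
  g ∈ T ∧ ∀ x ∈ T, parent x ∈ T

/-- `c` is a child of `a` in `T`: `c ∈ T`, `c ≠ g`, and `parent c = a`. -/
def IsChild {B : Type*} (g : B) (parent : B → B) (T : Finset B) (a c : B) : Prop :=
  c ∈ T ∧ c ≠ g ∧ parent c = a

open Classical in
/-- The weight of block `a` w.r.t. the vote set `W`: the number of distinct
validators casting a vote in `W` for a descendant of `a`. -/
noncomputable def wt {B V : Type*} (parent : B → B) (W : Finset (V × B)) (a : B) : ℕ :=
  ((W.filter (fun q => Ancestor parent a q.2)).image Prod.fst).card

/-- `ch 0, ch 1, …, ch k` is a greedy heaviest chain of `(T, W)`: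
it starts at the genesis `g`, consists of blocks of `T`, each step goes to a
child of maximal weight, and the endpoint `ch k` has no children in `T`. -/
def IsGreedyChain {B V : Type*} (g : B) (parent : B → B) (T : Finset B)
    (W : Finset (V × B)) (k : ℕ) (ch : ℕ → B) : Prop :=
  ch 0 = g ∧ (∀ i ≤ k, ch i ∈ T) ∧
  (∀ i < k, IsChild g parent T (ch i) (ch (i + 1)) ∧
      ∀ c', IsChild g parent T (ch i) c' → wt parent W c' ≤ wt parent W (ch (i + 1))) ∧
  ∀ c', ¬ IsChild g parent T (ch k) c'

theorem Ancestor.trans {B : Type*} {parent : B → B} {a b c : B}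
    (hab : Ancestor parent a b) (hbc : Ancestor parent b c) : Ancestor parent a c := by
  obtain ⟨k, rfl⟩ := hab
  obtain ⟨l, rfl⟩ := hbc
  exact ⟨k + l, (Function.iterate_add_apply parent k l c).symm⟩

/-- Two ancestors of the same block are comparable. -/
theorem Ancestor.total {B : Type*} {parent : B → B} {a b x : B}
    (ha : Ancestor parent a x) (hb : Ancestor parent b x) :
    Ancestor parent a b ∨ Ancestor parent b a := by
  obtain ⟨k, rfl⟩ := ha
  obtain ⟨l, rfl⟩ := hb
  rcases le_total k l with h | h
  · refine Or.inr ⟨l - k, ?_⟩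
    rw [← Function.iterate_add_apply, Nat.sub_add_cancel h]
  · refine Or.inl ⟨k - l, ?_⟩
    rw [← Function.iterate_add_apply, Nat.sub_add_cancel h]

/-- The only periodic point of `parent` is the genesis block. -/
theorem eq_genesis_of_iterate_parent_eq {B : Type*} {g : B} {parent : B → B}
    (hpg : parent g = g) {x : B} (hx : Ancestor parent g x) {n : ℕ} (hn : 1 ≤ n)
    (h : parent^[n] x = x) : x = g := by
  obtain ⟨m, hm⟩ := hx
  have hper : parent^[n * m] x = x := by
    rw [Function.iterate_mul]
    exact Function.iterate_fixed h m
  have hle : m ≤ n * m := Nat.le_mul_of_pos_left m hn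
  rw [← Nat.sub_add_cancel hle, Function.iterate_add_apply, ← hm,
    Function.iterate_fixed hpg] at hper
  exact hper.symm

/-- A child of a block that is an ancestor of another child of that block equals it. -/
theorem IsChild.eq_of_ancestor {B : Type*} {g : B} {parent : B → B} {T : Finset B}
    (hpg : parent g = g) (hanc : ∀ x, Ancestor parent g x) {a c d : B}
    (hc : IsChild g parent T a c) (hd : IsChild g parent T a d)
    (h : Ancestor parent c d) : c = d := by
  obtain ⟨k, hk⟩ := h
  cases k with
  | zero => exact hk
  | succ k =>
    refine absurd (eq_genesis_of_iterate_parent_eq hpg (hanc c) (Nat.succ_pos k) ?_) hc.2.1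
    rw [Function.iterate_succ_apply, hd.2.2] at hk
    rw [Function.iterate_succ_apply, hc.2.2, ← hk]

/-- Distinct children of a block have no common descendant. -/
theorem IsChild.eq_of_common_descendant {B : Type*} {g : B} {parent : B → B} {T : Finset B}
    (hpg : parent g = g) (hanc : ∀ x, Ancestor parent g x) {a c d x : B}
    (hc : IsChild g parent T a c) (hd : IsChild g parent T a d)
    (hcx : Ancestor parent c x) (hdx : Ancestor parent d x) : c = d := by
  rcases hcx.total hdx with h | h
  · exact hc.eq_of_ancestor hpg hanc hd h
  · exact (hd.eq_of_ancestor hpg hanc hc h).symm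

theorem IsBlocktree.iterate_mem {B : Type*} {g : B} {parent : B → B} {T : Finset B}
    (hT : IsBlocktree g parent T) {b : B} (hb : b ∈ T) (k : ℕ) : parent^[k] b ∈ T := by
  induction k with
  | zero => exact hb
  | succ k ih =>
    rw [Function.iterate_succ_apply']
    exact hT.2 _ ih

/-- A strict ancestor of a block `b` of the tree has a child that is an ancestor of `b`. -/
theorem IsBlocktree.exists_child_ancestor {B : Type*} {g : B} {parent : B → B} {T : Finset B}
    (hpg : parent g = g) (hT : IsBlocktree g parent T) {a b : B} (hb : b ∈ T)
    (hab : Ancestor parent a b) (hne : a ≠ b) :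
    ∃ c, IsChild g parent T a c ∧ Ancestor parent c b := by
  obtain ⟨k, hk⟩ := hab
  induction k with
  | zero => exact absurd hk hne
  | succ k ih =>
    rw [Function.iterate_succ_apply'] at hk
    by_cases hg : parent^[k] b = g
    · exact ih (by rw [hk, hg, hpg])
    · exact ⟨parent^[k] b, ⟨hT.iterate_mem hb k, hg, hk.symm⟩, k, rfl⟩

/-- The blocks of a greedy chain are ancestors of its endpoint. -/
theorem IsGreedyChain.ancestor_endpoint {B V : Type*} {g : B} {parent : B → B} {T : Finset B}
    {W : Finset (V × B)} {k : ℕ} {ch : ℕ → B} (h : IsGreedyChain g parent T W k ch)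
    {i : ℕ} (hi : i ≤ k) : Ancestor parent (ch i) (ch k) := by
  induction hi using Nat.decreasingInduction with
  | self => exact ⟨0, rfl⟩
  | of_succ j hj ih => exact Ancestor.trans ⟨1, (h.2.2.1 j hj).1.2.2.symm⟩ ih

theorem card_voters_le_wt {B V : Type*} [DecidableEq V] {parent : B → B}
    {H W : Finset (V × B)} {a : B} (hHW : H ⊆ W) (hH : ∀ q ∈ H, Ancestor parent a q.2) :
    (H.image Prod.fst).card ≤ wt parent W a := by
  refine Finset.card_le_card fun v hv => ?_
  obtain ⟨q, hq, rfl⟩ := Finset.mem_image.1 hv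
  simp only [Finset.mem_image, Finset.mem_filter]
  exact ⟨q, ⟨hHW hq, hH q hq⟩, rfl⟩

theorem wt_le_card_voters {B V : Type*} [DecidableEq V] {parent : B → B}
    {A W : Finset (V × B)} {a : B} (hW : ∀ q ∈ W, Ancestor parent a q.2 → q ∈ A) :
    wt parent W a ≤ (A.image Prod.fst).card := by
  refine Finset.card_le_card fun v hv => ?_
  simp only [Finset.mem_image, Finset.mem_filter] at hv
  obtain ⟨q, ⟨hqW, hq⟩, rfl⟩ := hv
  exact Finset.mem_image.2 ⟨q, hW q hqW hq, rfl⟩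

/-- If the votes for descendants of `b` come from more validators than the remaining votes,
then every greedy heaviest chain contains `b`. -/
theorem IsGreedyChain.exists_eq_of_majority {B V : Type*} [DecidableEq B] [DecidableEq V]
    {g : B} {parent : B → B} (hpg : parent g = g) (hanc : ∀ x, Ancestor parent g x)
    {T : Finset B} (hT : IsBlocktree g parent T) {b : B} (hb : b ∈ T)
    {H A W : Finset (V × B)} (hmaj : (A.image Prod.fst).card < (H.image Prod.fst).card)
    (hH : ∀ q ∈ H, Ancestor parent b q.2) (hHW : H ⊆ W) (hWA : W ⊆ H ∪ A)
    {k : ℕ} {ch : ℕ → B} (hch : IsGreedyChain g parent T W k ch) : ∃ i ≤ k, ch i = b := by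
  by_contra! hne
  have hanc_b : ∀ i ≤ k, Ancestor parent (ch i) b := by
    intro i
    induction i with
    | zero => exact fun _ => hch.1 ▸ hanc b
    | succ i ih =>
      intro hi
      obtain ⟨c, hc, hcb⟩ :=
        hT.exists_child_ancestor hpg hb (ih (by omega)) (hne i (by omega))
      obtain ⟨hd, hmax⟩ := hch.2.2.1 i hi
      by_contra hnd
      have hlow := card_voters_le_wt hHW fun q hq => hcb.trans (hH q hq)
      have hup : wt parent W (ch (i + 1)) ≤ (A.image Prod.fst).card := by
        refine wt_le_card_voters fun q hqW hq => ?_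
        refine (Finset.mem_union.1 (hWA hqW)).resolve_left fun hqH => hnd ?_
        rwa [hd.eq_of_common_descendant hpg hanc hc hq (hcb.trans (hH q hqH))]
      have := hmax c hc
      omega
  obtain ⟨c, hc, -⟩ := hT.exists_child_ancestor hpg hb (hanc_b k le_rfl) (hne k le_rfl)
  exact hch.2.2.2 c hc

/-- An inductive "voting together" lemma: if in slot `0` all
honest votes are for descendants of `b ∈ T`, honest voters outnumber adversarial
voters in each slot `s ≤ N`, and every honest slot-`s` vote (`1 ≤ s ≤ N`) is for
the endpoint of a greedy heaviest chain of `(T, W)` for some `W` squeezed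
between `H (s-1)` and `H (s-1) ∪ A (s-1)`, then in every slot `s ≤ N` all honest
votes are for descendants of `b`, and for every `W` with
`H s ⊆ W ⊆ H s ∪ A s`, every greedy heaviest chain of `(T, W)` contains `b`. -/
theorem honest_votes_stay_in_subtree
    {B V : Type*} [DecidableEq B] [DecidableEq V]
    (g : B) (parent : B → B) (hpg : parent g = g) (hanc : ∀ x, Ancestor parent g x)
    (T : Finset B) (hT : IsBlocktree g parent T) (b : B) (hb : b ∈ T)
    (N : ℕ) (H A : ℕ → Finset (V × B))
    (hdisj : ∀ s ≤ N, ∀ v : V, (∃ c, (v, c) ∈ H s) → ¬ ∃ c, (v, c) ∈ A s)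
    (hmaj : ∀ s ≤ N, ((A s).image Prod.fst).card < ((H s).image Prod.fst).card)
    (h0 : ∀ q ∈ H 0, Ancestor parent b q.2)
    (hstep : ∀ s, 1 ≤ s → s ≤ N → ∀ v c, (v, c) ∈ H s →
      ∃ W : Finset (V × B), H (s - 1) ⊆ W ∧ W ⊆ H (s - 1) ∪ A (s - 1) ∧
        ∃ k ch, IsGreedyChain g parent T W k ch ∧ ch k = c) :
    ∀ s ≤ N, (∀ q ∈ H s, Ancestor parent b q.2) ∧
      ∀ W : Finset (V × B), H s ⊆ W → W ⊆ H s ∪ A s →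
        ∀ k ch, IsGreedyChain g parent T W k ch → ∃ i ≤ k, ch i = b := by
  have hchain : ∀ s ≤ N, (∀ q ∈ H s, Ancestor parent b q.2) →
      ∀ W : Finset (V × B), H s ⊆ W → W ⊆ H s ∪ A s →
        ∀ k ch, IsGreedyChain g parent T W k ch → ∃ i ≤ k, ch i = b :=
    fun s hs hH W hHW hWA k ch hch =>
      hch.exists_eq_of_majority hpg hanc hT hb (hmaj s hs) hH hHW hWA
  have hvotes : ∀ s ≤ N, ∀ q ∈ H s, Ancestor parent b q.2 := by
    intro s
    induction s with
    | zero => exact fun _ => h0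
    | succ s ih =>
      rintro hs ⟨v, c⟩ hq
      obtain ⟨W, hHW, hWA, k, ch, hch, rfl⟩ := hstep (s + 1) (by omega) hs v c hq
      obtain ⟨i, hi, rfl⟩ :=
        hchain s (by omega) (ih (by omega)) W hHW hWA k ch hch
      exact hch.ancestor_endpoint hi
  exact fun s hs => ⟨hvotes s hs, hchain s hs (hvotes s hs)⟩
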